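/- arXiv:1910.13781 — 6 statements merged into one kernel-verified Lean document; each statement's English description precedes it below -/
import Mathlib

section
/- Let M be a ℂ-vector space and let E, F, X, Y be a Smith-type system with parameters (a,b,c) ∈ ℂ³ on M. Suppose v ∈ M satisfies X v = x₀·v, Y v = y₀·v and F v = 0, and suppose that for some integer n ≥ 1 one has Eⁿ v = 0 while E^{n−1} v ≠ 0. Then ∑_{j=0}^{n−1} ( a·(x₀+j)² + b·(x₀+j) + c·y₀ ) = 0. -/
/-- If `[X, E] = E` and `v` is an eigenvector of `X`, then `E` raises its weight by one. -/
theorem apply_pow_apply_of_commutator_eq_self {R M : Type*} [CommRing R] [AddCommGroup M]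
    [Module R M] {E X : Module.End R M} (hXE : X * E - E * X = E) {v : M} {x : R}
    (hX : X v = x • v) (j : ℕ) : X ((E ^ j) v) = (x + (j : R)) • (E ^ j) v := by
  induction j with
  | zero => simpa using hX
  | succ j ih =>
    have h := LinearMap.congr_fun hXE ((E ^ j) v)
    simp only [LinearMap.sub_apply, Module.End.mul_apply, ih, map_smul] at h
    rw [pow_succ', Module.End.mul_apply, sub_eq_iff_eq_add.mp h]
    push_cast
    module

/-- If `F v = 0` and `[E, F]` acts on each `E ^ j v` by the scalar `g j`, then `F` sends
`E ^ m v` to a multiple of `E ^ (m - 1) v` given by a partial sum of `g`. -/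
theorem apply_pow_succ_apply_eq_neg_sum_smul {R M : Type*} [CommRing R] [AddCommGroup M]
    [Module R M] {E F : Module.End R M} {v : M} (hF : F v = 0) {g : ℕ → R}
    (hg : ∀ j, (E * F - F * E) ((E ^ j) v) = g j • (E ^ j) v) (m : ℕ) :
    F ((E ^ (m + 1)) v) = -(∑ j ∈ Finset.range (m + 1), g j) • (E ^ m) v := by
  have step (j : ℕ) : F ((E ^ (j + 1)) v) = E (F ((E ^ j) v)) - g j • (E ^ j) v := by
    rw [← hg j, pow_succ', LinearMap.sub_apply]
    simp only [Module.End.mul_apply]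
    abel
  induction m with
  | zero => simpa [hF] using step 0
  | succ m ih =>
    rw [step, ih, map_smul, ← Module.End.mul_apply, ← pow_succ', Finset.sum_range_succ _ (m + 1)]
    module


/-- If in addition `Eⁿ v = 0` and `E^(n−1) v ≠ 0` for some `n ≥ 1`, then
`∑_{j=0}^{n−1} ( a·(x₀+j)² + b·(x₀+j) + c·y₀ ) = 0`. -/
theorem smith_top_level_dimension_condition
    (M : Type*) [AddCommGroup M] [Module ℂ M]
    (a b c : ℂ) (E F X Y : Module.End ℂ M)
    (hXE : X * E - E * X = E)
    (hXF : X * F - F * X = -F)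
    (hYE : Y * E = E * Y)
    (hYF : Y * F = F * Y)
    (hYX : Y * X = X * Y)
    (hEF : E * F - F * E = a • X ^ 2 + b • X + c • Y)
    (v : M) (x₀ y₀ : ℂ)
    (hX : X v = x₀ • v) (hY : Y v = y₀ • v) (hF : F v = 0)
    (n : ℕ) (hn : 1 ≤ n)
    (hEn : (E ^ n) v = 0) (hEn1 : (E ^ (n - 1)) v ≠ 0) :
    ∑ j ∈ Finset.range n,
      (a * (x₀ + (j : ℂ)) ^ 2 + b * (x₀ + (j : ℂ)) + c * y₀) = 0 := by
  have hYj (j : ℕ) : Y ((E ^ j) v) = y₀ • (E ^ j) v := by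
    have h := LinearMap.congr_fun (Commute.pow_right hYE j).eq v
    simpa only [Module.End.mul_apply, hY, map_smul] using h
  obtain ⟨m, rfl⟩ := Nat.exists_eq_add_of_le' hn
  have key := apply_pow_succ_apply_eq_neg_sum_smul hF
    (g := fun j : ℕ ↦ a * (x₀ + (j : ℂ)) ^ 2 + b * (x₀ + (j : ℂ)) + c * y₀) (E := E)
    (fun j ↦ by
      simp only [hEF, LinearMap.add_apply, LinearMap.smul_apply, pow_two X, Module.End.mul_apply,
        apply_pow_apply_of_commutator_eq_self hXE hX, map_smul, hYj]
      module) m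
  rw [hEn, map_zero] at key
  exact neg_eq_zero.mp ((smul_eq_zero.mp key.symm).resolve_right hEn1)
end

section
/- Let M be a ℂ-vector space and let E, F, X, Y be a Smith-type system with parameters (a,b,c) ∈ ℂ³ on M. Suppose 0 ≠ v ∈ M satisfies X v = x₀·v, Y v = y₀·v and F v = 0, and suppose that E^N v = 0 for some integer N ≥ 1. Then there exists an integer n with 1 ≤ n ≤ N such that ∑_{j=0}^{n−1} ( a·(x₀+j)² + b·(x₀+j) + c·y₀ ) = 0. -/
namespace Module.End

variable {R M : Type*} [CommRing R] [AddCommGroup M] [Module R M]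

/-- A raising operator for `X` shifts `X`-eigenvalues by one. -/
theorem apply_pow_apply_of_raising {E X : Module.End R M} (hXE : X * E - E * X = E)
    {v : M} {x : R} (hX : X v = x • v) (n : ℕ) :
    X ((E ^ n) v) = (x + (n : R)) • (E ^ n) v := by
  induction n with
  | zero => simpa using hX
  | succ n ih =>
    have h := LinearMap.congr_fun hXE ((E ^ n) v)
    simp only [LinearMap.sub_apply, Module.End.mul_apply, ih, map_smul] at h
    rw [pow_succ', Module.End.mul_apply, sub_eq_iff_eq_add.mp h]
    push_cast
    module

/-- An endomorphism commuting with `E` acts on all `E ^ n v` by its eigenvalue on `v`. -/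
theorem apply_pow_apply_of_commute {E Y : Module.End R M} (hYE : Commute Y E)
    {v : M} {y : R} (hY : Y v = y • v) (n : ℕ) :
    Y ((E ^ n) v) = y • (E ^ n) v := by
  rw [← Module.End.mul_apply, (hYE.pow_right n).eq, Module.End.mul_apply, hY, map_smul]

/-- In a Smith-type system, `F` lowers `E ^ (n + 1) v` to a multiple of `E ^ n v`
when `v` is a highest weight vector. -/
theorem apply_pow_succ_apply_of_smith {a b c : R} {E F X Y : Module.End R M}
    (hXE : X * E - E * X = E) (hYE : Commute Y E)
    (hEF : E * F - F * E = a • X ^ 2 + b • X + c • Y)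
    {v : M} {x y : R} (hX : X v = x • v) (hY : Y v = y • v) (hF : F v = 0) (n : ℕ) :
    F ((E ^ (n + 1)) v) =
      -(∑ j ∈ Finset.range (n + 1),
        (a * (x + (j : R)) ^ 2 + b * (x + (j : R)) + c * y)) • (E ^ n) v := by
  have key (m : ℕ) : F ((E ^ (m + 1)) v) = E (F ((E ^ m) v)) -
      (a * (x + (m : R)) ^ 2 + b * (x + (m : R)) + c * y) • (E ^ m) v := by
    have h := LinearMap.congr_fun hEF ((E ^ m) v)
    simp only [LinearMap.sub_apply, LinearMap.add_apply, LinearMap.smul_apply, pow_two X,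
      Module.End.mul_apply, apply_pow_apply_of_raising hXE hX,
      apply_pow_apply_of_commute hYE hY, map_smul] at h
    rw [pow_succ', Module.End.mul_apply, ← sub_sub_cancel (E (F ((E ^ m) v))) (F _), h]
    module
  induction n with
  | zero => rw [key 0]; simp [hF, -neg_add_rev]
  | succ n ih =>
    rw [key (n + 1), ih, Finset.sum_range_succ _ (n + 1), map_smul, ← Module.End.mul_apply,
      ← pow_succ']
    module

end Module.End

/-- If `v ≠ 0` is a highest weight vector and `E^N v = 0` for some `N ≥ 1`,
then `∑_{j=0}^{n−1} ( a·(x₀+j)² + b·(x₀+j) + c·y₀ ) = 0` for some `1 ≤ n ≤ N`. -/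
theorem smith_necessary_condition_some_n
    (M : Type*) [AddCommGroup M] [Module ℂ M]
    (a b c : ℂ) (E F X Y : Module.End ℂ M)
    (hXE : X * E - E * X = E)
    (hXF : X * F - F * X = -F)
    (hYE : Y * E = E * Y)
    (hYF : Y * F = F * Y)
    (hYX : Y * X = X * Y)
    (hEF : E * F - F * E = a • X ^ 2 + b • X + c • Y)
    (v : M) (hv : v ≠ 0) (x₀ y₀ : ℂ)
    (hX : X v = x₀ • v) (hY : Y v = y₀ • v) (hF : F v = 0)
    (N : ℕ) (hN : 1 ≤ N) (hEN : (E ^ N) v = 0) :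
    ∃ n : ℕ, 1 ≤ n ∧ n ≤ N ∧
      ∑ j ∈ Finset.range n,
        (a * (x₀ + (j : ℂ)) ^ 2 + b * (x₀ + (j : ℂ)) + c * y₀) = 0 := by
  classical
  have hex : ∃ n, (E ^ n) v = 0 := ⟨N, hEN⟩
  obtain ⟨m, hm⟩ : ∃ m, Nat.find hex = m + 1 :=
    Nat.exists_eq_succ_of_ne_zero fun h => hv (by simpa [h] using Nat.find_spec hex)
  have hzero : (E ^ (m + 1)) v = 0 := hm ▸ Nat.find_spec hex
  have hne : (E ^ m) v ≠ 0 := Nat.find_min hex (by lia)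
  refine ⟨m + 1, by lia, hm ▸ Nat.find_min' hex hEN, ?_⟩
  have h := Module.End.apply_pow_succ_apply_of_smith hXE hYE hEF hX hY hF m
  rw [hzero, map_zero, eq_comm, smul_eq_zero_iff_left hne, neg_eq_zero] at h
  exact h
end

section
/- Let k = −9/4 and, for a positive integer i, let h_i(x,y) = (1/i)·∑_{j=0}^{i−1} ( −3(x+j)² + (2k+3)(x+j) + (k+3)y ). Then for every integer i ≥ 1: h_i(0, −1/2) = −(1/8)(2i−1)(4i−1) ≠ 0, h_i(1/2, −1/2) = −(1/8)(2i+1)(4i+1) ≠ 0, and h_i(1/4, −1/2) = −(1/16)(4i−1)(4i+1) ≠ 0. -/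
/-- Closed form for the sum of a quadratic polynomial along an arithmetic progression of step one. -/
theorem sum_range_quadratic_shift (a b c x : ℂ) (n : ℕ) :
    ∑ j ∈ Finset.range n, (a * (x + (j : ℂ)) ^ 2 + b * (x + (j : ℂ)) + c) =
      n * (a * (x ^ 2 + x * (n - 1) + (n - 1) * (2 * n - 1) / 6) + b * (x + (n - 1) / 2) + c) := by
  induction n with
  | zero => simp
  | succ n ih =>
    rw [Finset.sum_range_succ, ih]
    push_cast
    ring

/-- At level `k = −9/4`, the quantities `h_i(x, −1/2)` for
`x ∈ {0, 1/2, 1/4}` have the stated closed forms and never vanish for `i ≥ 1`. -/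
theorem h_i_nonvanishing_level_minus_nine_fourths
    (k : ℂ) (hk : k = -9/4)
    (h : ℕ → ℂ → ℂ → ℂ)
    (hh : ∀ (i : ℕ) (x y : ℂ), h i x y =
      (1 / (i : ℂ)) *
        ∑ j ∈ Finset.range i,
          (-3 * (x + (j : ℂ)) ^ 2 + (2 * k + 3) * (x + (j : ℂ)) + (k + 3) * y)) :
    ∀ i : ℕ, 1 ≤ i →
      (h i 0 (-1/2) = -(1/8) * (2 * (i : ℂ) - 1) * (4 * (i : ℂ) - 1) ∧
        h i 0 (-1/2) ≠ 0) ∧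
      (h i (1/2) (-1/2) = -(1/8) * (2 * (i : ℂ) + 1) * (4 * (i : ℂ) + 1) ∧
        h i (1/2) (-1/2) ≠ 0) ∧
      (h i (1/4) (-1/2) = -(1/16) * (4 * (i : ℂ) - 1) * (4 * (i : ℂ) + 1) ∧
        h i (1/4) (-1/2) ≠ 0) := by
  intro i hi
  have hi0 : (i : ℂ) ≠ 0 := Nat.cast_ne_zero.mpr (by omega)
  have closed_form (x y : ℂ) : h i x y =
      -3 * (x ^ 2 + x * (i - 1) + (i - 1) * (2 * i - 1) / 6) +
        (2 * k + 3) * (x + (i - 1) / 2) + (k + 3) * y := by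
    rw [hh, sum_range_quadratic_shift, one_div, inv_mul_cancel_left₀ hi0]
  have sub_ne (m : ℕ) (hm : 2 ≤ m) : (m : ℂ) * i - 1 ≠ 0 := by
    rw [sub_ne_zero]
    have : m * i ≠ 1 := by nlinarith
    exact_mod_cast this
  have add_ne (m : ℕ) : (m : ℂ) * i + 1 ≠ 0 := by
    exact_mod_cast Nat.succ_ne_zero (m * i)
  have h2 : 2 * (i : ℂ) - 1 ≠ 0 := sub_ne 2 le_rfl
  have h4 : 4 * (i : ℂ) - 1 ≠ 0 := sub_ne 4 (by norm_num)
  have h2' : 2 * (i : ℂ) + 1 ≠ 0 := add_ne 2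
  have h4' : 4 * (i : ℂ) + 1 ≠ 0 := add_ne 4
  have e0 : h i 0 (-1/2) = -(1/8) * (2 * (i : ℂ) - 1) * (4 * (i : ℂ) - 1) := by
    rw [closed_form, hk]
    ring
  have e1 : h i (1/2) (-1/2) = -(1/8) * (2 * (i : ℂ) + 1) * (4 * (i : ℂ) + 1) := by
    rw [closed_form, hk]
    ring
  have e2 : h i (1/4) (-1/2) = -(1/16) * (4 * (i : ℂ) - 1) * (4 * (i : ℂ) + 1) := by
    rw [closed_form, hk]
    ring
  refine ⟨⟨e0, ?_⟩, ⟨e1, ?_⟩, ⟨e2, ?_⟩⟩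
  · rw [e0]
    exact mul_ne_zero (mul_ne_zero (by norm_num) h2) h4
  · rw [e1]
    exact mul_ne_zero (mul_ne_zero (by norm_num) h2') h4'
  · rw [e2]
    exact mul_ne_zero (mul_ne_zero (by norm_num) h4) h4'
end

section
/- Let r ∈ ℂ and let ν = √6/8. On the ℂ-vector space V of finitely supported functions ℤ → ℂ with standard basis (δ_m)_{m ∈ ℤ}, define linear maps E, F, X, Y by E δ_m = ν·C(4(r+m),3)·δ_{m+1} where C(z,3) = z(z−1)(z−2)/6, F δ_m = ν·δ_{m−1}, X δ_m = (m + r − 1)·δ_m, and Y δ_m = −(1/2)·δ_m. Then XE − EX = E, XF − FX = −F, Y commutes with E, F, X, and EF − FE = −3X² − (3/2)X + (3/4)Y as linear maps on V. -/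
/-- The operators `E, F, X, Y` on finitely supported functions `ℤ → ℂ`
defined on the standard basis as stated form a Smith-type system with parameters
`(−3, −3/2, 3/4)` (i.e. `(−3, 2k+3, k+3)` for `k = −9/4`). -/
theorem top_level_smith_system
    (r ν : ℂ) (hν : ν = (Real.sqrt 6 : ℂ) / 8)
    (C : ℂ → ℂ) (hC : ∀ z : ℂ, C z = z * (z - 1) * (z - 2) / 6)
    (E F X Y : (ℤ →₀ ℂ) →ₗ[ℂ] (ℤ →₀ ℂ))
    (hE : ∀ m : ℤ, E (Finsupp.single m 1) =
      (ν * C (4 * (r + (m : ℂ)))) • Finsupp.single (m + 1) 1)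
    (hF : ∀ m : ℤ, F (Finsupp.single m 1) = ν • Finsupp.single (m - 1) 1)
    (hX : ∀ m : ℤ, X (Finsupp.single m 1) = ((m : ℂ) + r - 1) • Finsupp.single m 1)
    (hY : ∀ m : ℤ, Y (Finsupp.single m 1) = (-(1/2) : ℂ) • Finsupp.single m 1) :
    X * E - E * X = E ∧
    X * F - F * X = -F ∧
    Y * E = E * Y ∧ Y * F = F * Y ∧ Y * X = X * Y ∧
    E * F - F * E = (-3 : ℂ) • X ^ 2 - (3/2 : ℂ) • X + (3/4 : ℂ) • Y := by
  have hν2 : ν ^ 2 = 3 / 32 := by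
    have h6 : (Real.sqrt 6 : ℂ) ^ 2 = 6 := by
      rw [← Complex.ofReal_pow, Real.sq_sqrt (by norm_num)]
      norm_num
    rw [hν, div_pow, h6]
    norm_num
  have ext_basis : ∀ A B : (ℤ →₀ ℂ) →ₗ[ℂ] (ℤ →₀ ℂ),
      (∀ m : ℤ, A (Finsupp.single m 1) = B (Finsupp.single m 1)) → A = B :=
    fun A B h ↦ Finsupp.lhom_ext' fun m ↦ LinearMap.ext_ring (h m)
  refine ⟨?_, ?_, ?_, ?_, ?_, ?_⟩ <;> refine ext_basis _ _ fun m ↦ ?_ <;>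
    simp only [pow_two, LinearMap.sub_apply, LinearMap.add_apply, LinearMap.neg_apply,
      LinearMap.smul_apply, Module.End.mul_apply, hE, hF, hX, hY, map_smul, hC,
      add_sub_cancel_right, sub_add_cancel]
  · push_cast
    module
  · push_cast
    module
  · module
  · module
  · module
  · simp only [smul_smul, ← sub_smul, ← add_smul]
    congr 1
    push_cast
    linear_combination (-32 * ((m : ℂ) + r - 1) ^ 2 - 16 * ((m : ℂ) + r - 1) - 4) * hν2
end

section
/- Let r ∈ ℂ with 4r ∉ ℤ and let ν = √6/8. On the ℂ-vector space V of finitely supported functions ℤ → ℂ with standard basis (δ_m)_{m ∈ ℤ}, define linear maps E, F, X by E δ_m = ν·C(4(r+m),3)·δ_{m+1} where C(z,3) = z(z−1)(z−2)/6, F δ_m = ν·δ_{m−1}, and X δ_m = (m + r − 1)·δ_m. Then every ℂ-subspace W ⊆ V with E(W) ⊆ W, F(W) ⊆ W, X(W) ⊆ W and W ≠ {0} equals V. -/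
/-- A linear map acting on the standard basis by scalars acts coordinatewise. -/
lemma Finsupp.apply_of_diagonal {ι K : Type*} [Field K] (c : ι → K)
    (T : (ι →₀ K) →ₗ[K] (ι →₀ K))
    (hT : ∀ i, T (Finsupp.single i 1) = c i • Finsupp.single i 1) (v : ι →₀ K) (k : ι) :
    T v k = c k * v k := by
  classical
  induction v using Finsupp.induction_linear with
  | zero => simp
  | add f g hf hg => simp [hf, hg, mul_add]
  | single i a =>
    rw [← mul_one a, ← smul_eq_mul, ← Finsupp.smul_single, map_smul, hT]
    by_cases h : i = k
    · subst h
      simp [mul_comm]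
    · simp [h]

/-- A nonzero subspace invariant under a diagonal operator with pairwise distinct eigenvalues
contains a standard basis vector. -/
lemma Submodule.exists_single_mem_of_diagonal {ι K : Type*} [Field K] (c : ι → K)
    (hc : Function.Injective c) (T : (ι →₀ K) →ₗ[K] (ι →₀ K))
    (hT : ∀ i, T (Finsupp.single i 1) = c i • Finsupp.single i 1)
    (W : Submodule K (ι →₀ K)) (hW : ∀ v ∈ W, T v ∈ W) (hne : W ≠ ⊥) :
    ∃ i, Finsupp.single i 1 ∈ W := by
  classical
  obtain ⟨v, hv, hv0⟩ := W.ne_bot_iff.mp hne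
  induction hn : v.support.card using Nat.strong_induction_on generalizing v with
  | _ n ih =>
    obtain ⟨a, ha⟩ := Finsupp.ne_iff.mp hv0
    have ha : v a ≠ 0 := ha
    let w : ι →₀ K := T v - c a • v
    have hw : w ∈ W := W.sub_mem (hW v hv) (W.smul_mem _ hv)
    have hwk (k : ι) : w k = (c k - c a) * v k := by
      simp [w, Finsupp.apply_of_diagonal c T hT, sub_mul]
    by_cases hw0 : w = 0
    · have hva : v = Finsupp.single a (v a) := by
        ext k
        by_cases hk : a = k
        · simp [← hk]
        · have h := hwk k
          rw [hw0, Finsupp.zero_apply, eq_comm, mul_eq_zero, sub_eq_zero] at h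
          rw [Finsupp.single_apply, if_neg hk]
          exact h.resolve_left fun h' => hk (hc h').symm
      refine ⟨a, ?_⟩
      have h := W.smul_mem (v a)⁻¹ hv
      rwa [hva, Finsupp.smul_single, Finsupp.single_eq_same, smul_eq_mul,
        inv_mul_cancel₀ ha] at h
    · refine ih _ ?_ w hw hw0 rfl
      rw [← hn]
      refine Finset.card_lt_card ((Finset.ssubset_iff_of_subset fun k hk => ?_).mpr ⟨a, ?_, ?_⟩)
      · rw [Finsupp.mem_support_iff, hwk] at hk
        exact Finsupp.mem_support_iff.mpr (right_ne_zero_of_mul hk)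
      · exact Finsupp.mem_support_iff.mpr ha
      · simp [hwk]

/-- If `4r ∉ ℤ`, every nonzero subspace of `ℤ →₀ ℂ` invariant under the
operators `E, F, X` is the whole space (irreducibility of the top level of `M_{−1}(r)`). -/
theorem top_level_irreducible
    (r ν : ℂ) (hν : ν = (Real.sqrt 6 : ℂ) / 8)
    (hr : ∀ n : ℤ, 4 * r ≠ (n : ℂ))
    (C : ℂ → ℂ) (hC : ∀ z : ℂ, C z = z * (z - 1) * (z - 2) / 6)
    (E F X : (ℤ →₀ ℂ) →ₗ[ℂ] (ℤ →₀ ℂ))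
    (hE : ∀ m : ℤ, E (Finsupp.single m 1) =
      (ν * C (4 * (r + (m : ℂ)))) • Finsupp.single (m + 1) 1)
    (hF : ∀ m : ℤ, F (Finsupp.single m 1) = ν • Finsupp.single (m - 1) 1)
    (hX : ∀ m : ℤ, X (Finsupp.single m 1) = ((m : ℂ) + r - 1) • Finsupp.single m 1) :
    ∀ W : Submodule ℂ (ℤ →₀ ℂ),
      (∀ v ∈ W, E v ∈ W) → (∀ v ∈ W, F v ∈ W) → (∀ v ∈ W, X v ∈ W) →
      W ≠ ⊥ → W = ⊤ := by
  intro W hEW hFW hXW hne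
  have hν0 : ν ≠ 0 := by simp [hν]
  have hC0 (m : ℤ) : C (4 * (r + m)) ≠ 0 := by
    rw [hC]
    have h (j : ℤ) : 4 * (r + m) - j ≠ 0 := fun h => hr (j - 4 * m) <| by
      push_cast
      linear_combination h
    have h0 := h 0
    have h1 := h 1
    have h2 := h 2
    push_cast at h0 h1 h2
    rw [sub_zero] at h0
    exact div_ne_zero (mul_ne_zero (mul_ne_zero h0 h1) h2) (by norm_num)
  obtain ⟨a, ha⟩ := W.exists_single_mem_of_diagonal (fun m : ℤ => (m : ℂ) + r - 1)
    (fun m n h => by simpa using h) X hX hXW hne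
  have hmem (m : ℤ) : Finsupp.single m (1 : ℂ) ∈ W := by
    induction m using Int.inductionOn' (b := a) with
    | zero => exact ha
    | succ k _ hk =>
      exact (W.smul_mem_iff (mul_ne_zero hν0 (hC0 k))).mp (hE k ▸ hEW _ hk)
    | pred k _ hk => exact (W.smul_mem_iff hν0).mp (hF k ▸ hFW _ hk)
  refine W.eq_top_iff'.mpr fun v => ?_
  induction v using Finsupp.induction_linear with
  | zero => exact W.zero_mem
  | add f g hf hg => exact W.add_mem hf hg
  | single m x => simpa using W.smul_mem x (hmem m)
end

section
/- On M = ℂ², define linear maps E, F, X, Y by E(a,b) = (0,a), F = 0, X(a,b) = (0,b), Y = 0. Then: (i) XE − EX = E, XF − FX = −F, Y commutes with E, F, X, and EF − FE = −3X² + 3X + 3Y as linear maps on M; (ii) the ℂ-subspaces W ⊆ M satisfying E(W) ⊆ W and X(W) ⊆ W are exactly {0}, the line spanned by (0,1), and M itself; in particular M has a unique proper nonzero invariant subspace, so M is an indecomposable but not irreducible module for these operators. -/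
/-- A subspace of `K²` stable under `(a, b) ↦ (0, a)` and `(a, b) ↦ (0, b)` is `⊥`, the line
spanned by `(0, 1)`, or `⊤`. -/
theorem Submodule.eq_bot_or_eq_span_or_eq_top_of_forall_mem {K : Type*} [Field K]
    (W : Submodule K (K × K)) (hfst : ∀ w ∈ W, ((0 : K), w.1) ∈ W)
    (hsnd : ∀ w ∈ W, ((0 : K), w.2) ∈ W) :
    W = ⊥ ∨ W = Submodule.span K {((0 : K), (1 : K))} ∨ W = ⊤ := by
  have unit_mem : ∀ c : K, c ≠ 0 → ((0 : K), c) ∈ W → ((0 : K), (1 : K)) ∈ W := by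
    intro c hc h
    simpa [hc] using W.smul_mem c⁻¹ h
  by_cases hbot : W = ⊥
  · exact Or.inl hbot
  obtain ⟨⟨a, b⟩, hw, hne⟩ := W.exists_mem_ne_zero_of_ne_bot hbot
  have hone : ((0 : K), (1 : K)) ∈ W := by
    by_cases ha : a = 0
    · exact unit_mem b (fun hb => hne (by simp [ha, hb])) (hsnd _ hw)
    · exact unit_mem a ha (hfst _ hw)
  refine Or.inr ?_
  by_cases hline : ∀ w ∈ W, w.1 = 0
  · refine Or.inl (le_antisymm (fun w hwW => ?_) ?_)
    · exact Submodule.mem_span_singleton.2 ⟨w.2, by ext <;> simp [hline w hwW]⟩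
    · simpa [Submodule.span_singleton_le_iff_mem] using hone
  · push Not at hline
    obtain ⟨v, hv, hv1⟩ := hline
    refine Or.inr (Submodule.eq_top_iff'.2 fun u => ?_)
    have h := W.add_mem (W.smul_mem (u.1 / v.1) hv)
      (W.smul_mem (u.2 - u.1 / v.1 * v.2) hone)
    convert h using 1
    ext <;> simp [hv1]

/-- The line spanned by `(0, 1)` in `K²` is nonzero. -/
theorem Submodule.span_zero_one_ne_bot {K : Type*} [Field K] :
    Submodule.span K {((0 : K), (1 : K))} ≠ ⊥ := by
  simp

/-- The line spanned by `(0, 1)` in `K²` is proper. -/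
theorem Submodule.span_zero_one_ne_top {K : Type*} [Field K] :
    Submodule.span K {((0 : K), (1 : K))} ≠ ⊤ := by
  intro h
  have hmem : ((1 : K), (0 : K)) ∈ Submodule.span K {((0 : K), (1 : K))} := h ▸ Submodule.mem_top
  obtain ⟨c, hc⟩ := Submodule.mem_span_singleton.1 hmem
  simp at hc

/-- The explicit operators on `ℂ²` form a Smith-type system with parameters
`(−3, 3, 3)` (level `k = 0`), whose invariant subspaces are exactly `⊥`, the line spanned
by `(0,1)`, and `⊤`; in particular there is a unique proper nonzero invariant subspace,
so `ℂ²` is indecomposable but not irreducible. -/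
theorem two_dimensional_indecomposable_smith_module
    (E F X Y : (ℂ × ℂ) →ₗ[ℂ] (ℂ × ℂ))
    (hE : ∀ a b : ℂ, E (a, b) = (0, a))
    (hF : F = 0)
    (hX : ∀ a b : ℂ, X (a, b) = (0, b))
    (hY : Y = 0) :
    (X * E - E * X = E ∧
      X * F - F * X = -F ∧
      Y * E = E * Y ∧ Y * F = F * Y ∧ Y * X = X * Y ∧
      E * F - F * E = (-3 : ℂ) • X ^ 2 + (3 : ℂ) • X + (3 : ℂ) • Y) ∧
    (∀ W : Submodule ℂ (ℂ × ℂ),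
      ((∀ w ∈ W, E w ∈ W) ∧ (∀ w ∈ W, X w ∈ W)) ↔
        (W = ⊥ ∨ W = Submodule.span ℂ {((0 : ℂ), (1 : ℂ))} ∨ W = ⊤)) ∧
    (∃! W : Submodule ℂ (ℂ × ℂ),
      (∀ w ∈ W, E w ∈ W) ∧ (∀ w ∈ W, X w ∈ W) ∧ W ≠ ⊥ ∧ W ≠ ⊤) := by
  have hiff : ∀ W : Submodule ℂ (ℂ × ℂ),
      ((∀ w ∈ W, E w ∈ W) ∧ (∀ w ∈ W, X w ∈ W)) ↔
        (W = ⊥ ∨ W = Submodule.span ℂ {((0 : ℂ), (1 : ℂ))} ∨ W = ⊤) := by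
    intro W
    constructor
    · rintro ⟨hEW, hXW⟩
      exact W.eq_bot_or_eq_span_or_eq_top_of_forall_mem
        (fun w hw => hE w.1 w.2 ▸ hEW w hw) (fun w hw => hX w.1 w.2 ▸ hXW w hw)
    · have hline : ∀ c : ℂ, ((0 : ℂ), c) ∈ Submodule.span ℂ {((0 : ℂ), (1 : ℂ))} :=
        fun c => Submodule.mem_span_singleton.2 ⟨c, by simp⟩
      rintro (rfl | rfl | rfl)
      · simp
      · exact ⟨fun w _ => hE w.1 w.2 ▸ hline w.1, fun w _ => hX w.1 w.2 ▸ hline w.2⟩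
      · simp
  refine ⟨?_, hiff, ?_⟩
  · subst hF hY
    have hXE : X * E = E := LinearMap.ext fun ⟨a, b⟩ => by simp [hE, hX]
    have hEX : E * X = 0 := LinearMap.ext fun ⟨a, b⟩ => by simp [hE, hX]
    have hXX : X ^ 2 = X := LinearMap.ext fun ⟨a, b⟩ => by simp [pow_two, hX]
    simp [hXE, hEX, hXX, ← add_smul]
  · obtain ⟨hEL, hXL⟩ := (hiff _).2 (Or.inr (Or.inl rfl))
    refine ⟨_, ⟨hEL, hXL, Submodule.span_zero_one_ne_bot, Submodule.span_zero_one_ne_top⟩, ?_⟩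
    rintro W ⟨hEW, hXW, hbot, htop⟩
    exact (((hiff W).1 ⟨hEW, hXW⟩).resolve_left hbot).resolve_right htop
end
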